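/- arXiv:2502.01065 — 3 statements merged into one kernel-verified Lean document; each statement's English description precedes it below -/
import Mathlib

section
/- For every finite simple graph G = (V,E) with set of isolated vertices I (vertices of degree 0), E(G) ≤ 2·e₁₁ + √(2·(|V| − |L| − |I|)·(|E| + |L| − 3·e₁₁)). -/
open Finset

namespace GraphEnergy

variable {V : Type*} [Fintype V] [DecidableEq V]

/-- The adjacency matrix of a simple graph over `ℝ` is Hermitian. -/
theorem adjMatrix_isHermitian (G : SimpleGraph V) [DecidableRel G.Adj] :
    (G.adjMatrix ℝ).IsHermitian := by
  ext i j
  simp [Matrix.conjTranspose_apply, SimpleGraph.adj_comm]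

/-- The energy of a finite simple graph: the sum of the absolute values of the
eigenvalues of its adjacency matrix. -/
noncomputable def energy (G : SimpleGraph V) [DecidableRel G.Adj] : ℝ :=
  ∑ i, |(adjMatrix_isHermitian G).eigenvalues i|

/-- The set of inner vertices: vertices of degree at least 2. -/
def innerVerts (G : SimpleGraph V) [DecidableRel G.Adj] : Finset V :=
  univ.filter (fun v => 2 ≤ G.degree v)

/-- The set of leaves: vertices of degree 1. -/
def leaves (G : SimpleGraph V) [DecidableRel G.Adj] : Finset V :=
  univ.filter (fun v => G.degree v = 1)

/-- The number of neighbors of `v` that are leaves. -/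
def leafCount (G : SimpleGraph V) [DecidableRel G.Adj] (v : V) : ℕ :=
  ((G.neighborFinset v).filter (fun w => G.degree w = 1)).card

open scoped Classical in
/-- The number of edges both of whose endpoints are leaves. -/
noncomputable def e11 (G : SimpleGraph V) [DecidableRel G.Adj] : ℕ :=
  (G.edgeFinset.filter (fun e => ∀ v ∈ e, G.degree v = 1)).card

/-- Twice the number of edges is the sum of the entries of the adjacency matrix. -/
theorem sum_adj_eq_two_mul_card_edgeFinset (G : SimpleGraph V) [DecidableRel G.Adj] :
    ∑ i, ∑ j, (if G.Adj i j then (1 : ℝ) else 0) = 2 * (G.edgeFinset.card : ℝ) := by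
  have h := G.sum_degrees_eq_twice_card_edges
  have h' : ∑ i, (G.degree i : ℝ) = 2 * (G.edgeFinset.card : ℝ) := by exact_mod_cast h
  rw [← h']
  refine sum_congr rfl fun i _ => ?_
  rw [← G.card_neighborFinset_eq_degree, G.neighborFinset_eq_filter, sum_boole]

/-- The number of leaves, counted through the edges at leaves. -/
theorem sum_adj_leaf_eq_card_leaves (G : SimpleGraph V) [DecidableRel G.Adj] :
    ∑ i, ∑ j, (if G.Adj i j ∧ G.degree i = 1 then (1 : ℝ) else 0) = ((leaves G).card : ℝ) := by
  rw [leaves, ← sum_boole]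
  refine sum_congr rfl fun i _ => ?_
  by_cases hi : G.degree i = 1
  · simp only [hi, and_true, if_true]
    rw [sum_boole, ← G.neighborFinset_eq_filter, G.card_neighborFinset_eq_degree, hi]
    simp
  · simp [hi]

/-- Twice the number of edges between leaves, as a sum over ordered pairs. -/
theorem sum_adj_leaf_leaf_eq_two_mul_e11 (G : SimpleGraph V) [DecidableRel G.Adj] :
    ∑ i, ∑ j, (if G.Adj i j ∧ G.degree i = 1 ∧ G.degree j = 1 then (1 : ℝ) else 0) =
      2 * (e11 G : ℝ) := by
  classical
  let H : SimpleGraph V :=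
    { Adj := fun i j => G.Adj i j ∧ G.degree i = 1 ∧ G.degree j = 1
      symm := ⟨fun _ _ h => ⟨h.1.symm, h.2.2, h.2.1⟩⟩
      loopless := ⟨fun _ h => G.loopless.irrefl _ h.1⟩ }
  have hH : e11 G = H.edgeFinset.card := by
    unfold e11
    congr 1
    ext e
    induction e with
    | _ i j => simp [H]
  rw [hH, ← sum_adj_eq_two_mul_card_edgeFinset]

/-- The sum of the absolute values of the eigenvalues of a real symmetric matrix `A` is attained
as `tr (A U)` for a symmetric orthogonal matrix `U`. -/
theorem exists_symm_orthogonal_sum_mul_eq_sum_abs_eigenvalues {A : Matrix V V ℝ}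
    (hA : A.IsHermitian) :
    ∃ U : Matrix V V ℝ, (∀ i j, U i j = U j i) ∧ (∀ i, ∑ j, U i j ^ 2 = 1) ∧
      ∑ i, |hA.eigenvalues i| = ∑ i, ∑ j, A i j * U i j := by
  let Q : Matrix V V ℝ := hA.eigenvectorUnitary
  let s : V → ℝ := fun k => if 0 ≤ hA.eigenvalues k then 1 else -1
  let U : Matrix V V ℝ := Q * Matrix.diagonal s * Q.transpose
  have hQ : Q.transpose * Q = 1 := by
    have h := Unitary.coe_star_mul_self hA.eigenvectorUnitary
    rwa [Matrix.star_eq_conjTranspose, Matrix.conjTranspose_eq_transpose_of_trivial] at h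
  have hQ' : Q * Q.transpose = 1 := mul_eq_one_comm.mp hQ
  have hspec : A = Q * Matrix.diagonal hA.eigenvalues * Q.transpose := by
    have h := hA.spectral_theorem
    rw [Unitary.conjStarAlgAut_apply, Matrix.star_eq_conjTranspose,
      Matrix.conjTranspose_eq_transpose_of_trivial] at h
    exact h
  have hs : Matrix.diagonal s * Matrix.diagonal s = 1 := by
    rw [Matrix.diagonal_mul_diagonal, ← Matrix.diagonal_one]
    congr 1
    funext k
    by_cases hk : 0 ≤ hA.eigenvalues k <;> simp [s, hk]
  have hU : U.transpose = U := by
    simp [U, Matrix.transpose_mul, Matrix.mul_assoc]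
  have hUU : U * U = 1 := by
    calc U * U = Q * Matrix.diagonal s * (Q.transpose * Q) * Matrix.diagonal s * Q.transpose := by
          simp only [U, Matrix.mul_assoc]
      _ = Q * (Matrix.diagonal s * Matrix.diagonal s) * Q.transpose := by
          simp only [hQ, Matrix.mul_one, Matrix.mul_assoc]
      _ = 1 := by rw [hs, Matrix.mul_one, hQ']
  have hsymm : ∀ i j, U i j = U j i := fun i j => congrFun (congrFun hU.symm i) j
  refine ⟨U, hsymm, fun i => ?_, ?_⟩
  · have h := congrFun (congrFun hUU i) i
    rw [Matrix.mul_apply, Matrix.one_apply_eq] at h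
    rw [← h]
    exact sum_congr rfl fun j _ => by rw [hsymm j i, sq]
  · have htr : (A * U).trace = ∑ i, |hA.eigenvalues i| := by
      calc (A * U).trace
          = (Q * Matrix.diagonal hA.eigenvalues * (Q.transpose * Q) * Matrix.diagonal s *
              Q.transpose).trace := by
            conv_lhs => rw [hspec]
            simp only [U, Matrix.mul_assoc]
        _ = (Q.transpose * Q * (Matrix.diagonal hA.eigenvalues * Matrix.diagonal s)).trace := by
            rw [hQ, Matrix.mul_one, Matrix.trace_mul_comm, ← hQ]
            simp only [Matrix.mul_assoc]
        _ = ∑ i, |hA.eigenvalues i| := by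
            rw [hQ, Matrix.one_mul, Matrix.diagonal_mul_diagonal, Matrix.trace_diagonal]
            refine sum_congr rfl fun k _ => ?_
            by_cases hk : 0 ≤ hA.eigenvalues k
            · simp [s, hk, abs_of_nonneg hk]
            · simp [s, hk, abs_of_neg (not_le.mp hk)]
    rw [← htr, Matrix.trace]
    refine sum_congr rfl fun i _ => ?_
    rw [Matrix.diag_apply, Matrix.mul_apply]
    exact sum_congr rfl fun j _ => by rw [hsymm j i]

/-- The weight which the star centred at an inner vertex `i` puts on the pair `(i, j)`: edges
between inner vertices are shared by both stars, and edges to leaves are counted twice. -/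
def starWeight (G : SimpleGraph V) [DecidableRel G.Adj] (i j : V) : ℝ :=
  if G.Adj i j ∧ G.degree i ≠ 1 then (if G.degree j = 1 then 2 else 1) else 0

theorem two_mul_adj_eq_starWeight (G : SimpleGraph V) [DecidableRel G.Adj] (i j : V) :
    2 * (if G.Adj i j then (1 : ℝ) else 0) = starWeight G i j + starWeight G j i +
      2 * (if G.Adj i j ∧ G.degree i = 1 ∧ G.degree j = 1 then 1 else 0) := by
  by_cases h : G.Adj i j <;> by_cases hi : G.degree i = 1 <;> by_cases hj : G.degree j = 1 <;>
    simp [starWeight, h, hi, hj, G.adj_comm j i]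
  norm_num

theorem starWeight_sq_add_starWeight_sq (G : SimpleGraph V) [DecidableRel G.Adj] (i j : V) :
    starWeight G i j ^ 2 + starWeight G j i ^ 2 = 2 * (if G.Adj i j then (1 : ℝ) else 0) +
      2 * (if G.Adj i j ∧ G.degree i = 1 then 1 else 0) +
      2 * (if G.Adj j i ∧ G.degree j = 1 then 1 else 0) -
      6 * (if G.Adj i j ∧ G.degree i = 1 ∧ G.degree j = 1 then 1 else 0) := by
  by_cases h : G.Adj i j <;> by_cases hi : G.degree i = 1 <;> by_cases hj : G.degree j = 1 <;>
    simp [starWeight, h, hi, hj, G.adj_comm j i] <;> norm_num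

theorem sum_starWeight_sq (G : SimpleGraph V) [DecidableRel G.Adj] :
    ∑ i, ∑ j, starWeight G i j ^ 2 =
      2 * ((G.edgeFinset.card : ℝ) + ((leaves G).card : ℝ) - 3 * (e11 G : ℝ)) := by
  have h : ∑ i, ∑ j, (starWeight G i j ^ 2 + starWeight G j i ^ 2) =
      ∑ i, ∑ j, (2 * (if G.Adj i j then (1 : ℝ) else 0) +
        2 * (if G.Adj i j ∧ G.degree i = 1 then 1 else 0) +
        2 * (if G.Adj j i ∧ G.degree j = 1 then 1 else 0) -
        6 * (if G.Adj i j ∧ G.degree i = 1 ∧ G.degree j = 1 then 1 else 0)) :=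
    sum_congr rfl fun i _ => sum_congr rfl fun j _ => starWeight_sq_add_starWeight_sq G i j
  simp only [sum_add_distrib, sum_sub_distrib, ← mul_sum] at h
  rw [sum_comm (f := fun i j => starWeight G j i ^ 2),
    sum_comm (f := fun i j => if G.Adj j i ∧ G.degree j = 1 then (1 : ℝ) else 0),
    sum_adj_eq_two_mul_card_edgeFinset, sum_adj_leaf_eq_card_leaves,
    sum_adj_leaf_leaf_eq_two_mul_e11] at h
  linarith

theorem starWeight_eq_zero_of_notMem_innerVerts (G : SimpleGraph V) [DecidableRel G.Adj]
    {i : V} (hi : i ∉ innerVerts G) (j : V) : starWeight G i j = 0 := by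
  refine if_neg fun ⟨hij, h1⟩ => hi ?_
  have h0 : 0 < G.degree i := (G.degree_pos_iff_exists_adj i).mpr ⟨j, hij⟩
  simp only [innerVerts, mem_filter, mem_univ, true_and]
  omega

theorem card_innerVerts (G : SimpleGraph V) [DecidableRel G.Adj] :
    ((innerVerts G).card : ℝ) = (Fintype.card V : ℝ) - ((leaves G).card : ℝ) -
      ((univ.filter (fun v => G.degree v = 0)).card : ℝ) := by
  rw [innerVerts, leaves, ← card_univ, card_eq_sum_ones univ, Nat.cast_sum, ← sum_boole,
    ← sum_boole, ← sum_boole, ← sum_sub_distrib, ← sum_sub_distrib]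
  refine sum_congr rfl fun v _ => ?_
  rcases h : G.degree v with _ | _ | d <;> simp

theorem sum_starWeight_mul_le (G : SimpleGraph V) [DecidableRel G.Adj] {U : Matrix V V ℝ}
    (hU : ∀ i, ∑ j, U i j ^ 2 = 1) :
    ∑ i, ∑ j, starWeight G i j * U i j ≤
      Real.sqrt (((innerVerts G).card : ℝ) * ∑ i, ∑ j, starWeight G i j ^ 2) := by
  have hsub : ∀ f : V → V → ℝ, (∀ i ∉ innerVerts G, ∀ j, f i j = 0) →
      ∑ i, ∑ j, f i j = ∑ p ∈ innerVerts G ×ˢ univ, f p.1 p.2 := fun f hf => by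
    rw [sum_product]
    exact (sum_subset (subset_univ _) fun i _ hi => sum_eq_zero fun j _ => hf i hi j).symm
  have hw := fun i hi j => starWeight_eq_zero_of_notMem_innerVerts G (i := i) hi j
  rw [hsub _ fun i hi j => by rw [hw i hi j, zero_mul],
    hsub (fun i j => starWeight G i j ^ 2) fun i hi j => by rw [hw i hi j]; norm_num]
  refine Real.le_sqrt_of_sq_le ((sum_mul_sq_le_sq_mul_sq _ _ _).trans_eq ?_)
  rw [mul_comm, sum_product (f := fun p => U p.1 p.2 ^ 2)]
  simp [hU]

/-- For any graph with set of isolated vertices `I`,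
`E(G) ≤ 2 e₁₁ + √(2 (|V| - |L| - |I|)(|E| + |L| - 3 e₁₁))`. -/
theorem energy_le_global_bound_isolated (G : SimpleGraph V) [DecidableRel G.Adj] :
    energy G ≤ 2 * (e11 G : ℝ) +
      Real.sqrt (2 * ((Fintype.card V : ℝ) - ((leaves G).card : ℝ) -
          ((univ.filter (fun v => G.degree v = 0)).card : ℝ)) *
        ((G.edgeFinset.card : ℝ) + ((leaves G).card : ℝ) - 3 * (e11 G : ℝ))) := by
  obtain ⟨U, hsymm, hU, hE⟩ :=
    exists_symm_orthogonal_sum_mul_eq_sum_abs_eigenvalues (adjMatrix_isHermitian G)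
  have hsplit : ∑ i, ∑ j, 2 * (G.adjMatrix ℝ i j * U i j) =
      ∑ i, ∑ j, (starWeight G i j * U i j + starWeight G j i * U j i +
        2 * ((if G.Adj i j ∧ G.degree i = 1 ∧ G.degree j = 1 then 1 else 0) * U i j)) := by
    refine sum_congr rfl fun i _ => sum_congr rfl fun j _ => ?_
    rw [SimpleGraph.adjMatrix_apply, ← mul_assoc, two_mul_adj_eq_starWeight, hsymm j i]
    ring
  have hleaf : ∑ i, ∑ j,
      (if G.Adj i j ∧ G.degree i = 1 ∧ G.degree j = 1 then (1 : ℝ) else 0) * U i j ≤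
        2 * (e11 G : ℝ) := by
    rw [← sum_adj_leaf_leaf_eq_two_mul_e11]
    refine sum_le_sum fun i _ => sum_le_sum fun j _ => ?_
    have h1 : U i j ^ 2 ≤ 1 :=
      (single_le_sum (f := fun j => U i j ^ 2) (fun _ _ => sq_nonneg _) (mem_univ j)).trans_eq
        (hU i)
    have h2 : U i j ≤ 1 := (abs_le.mp ((sq_le_one_iff_abs_le_one _).mp h1)).2
    exact mul_le_of_le_one_right (by split_ifs <;> norm_num) h2
  have hstar := sum_starWeight_mul_le G hU
  rw [sum_starWeight_sq, card_innerVerts, mul_left_comm, ← mul_assoc] at hstar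
  simp only [sum_add_distrib, ← mul_sum] at hsplit
  rw [sum_comm (f := fun i j => starWeight G j i * U j i)] at hsplit
  rw [energy, hE]
  linarith

end GraphEnergy
end

section
/- Let T = (V,E) be a tree with n ≥ 3 vertices, maximum degree Δ, V₁ = {v ∈ V' : δ(v) = 1}, V₂ = {v ∈ V' : δ(v) ≥ 2}, l₁ = min_{v ∈ V₁} l(v) and l₂ = max_{v ∈ V₂} l(v). If (√(l₂ + 1) − √(l₂ + 1/2))·|V₂| ≥ (√(l₁ + 1/4) − √(l₁))·|V₁|, then Σ_{v ∈ V'} √(3·l(v) + d(v)) ≤ Σ_{v ∈ V} 2·√(d(v) − 1) + 2·(√Δ − √(Δ − 1)). -/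
open Finset

namespace GraphEnergy

variable {V : Type*} [Fintype V] [DecidableEq V]

/-- The number of neighbors of `v` of degree greater than 1. -/
def innerCount (G : SimpleGraph V) [DecidableRel G.Adj] (v : V) : ℕ :=
  ((G.neighborFinset v).filter (fun w => 1 < G.degree w)).card

/-- The auxiliary function `f(x,y) = √(4x + 4(y-1)) - √(4x + y)`. -/
noncomputable def auxf (x y : ℝ) : ℝ :=
  Real.sqrt (4 * x + 4 * (y - 1)) - Real.sqrt (4 * x + y)

theorem sqrt_add_sqrt_le_sqrt_add_sqrt {p q r s : ℝ} (hp : 0 ≤ p) (hq : 0 ≤ q) (hr : 0 ≤ r)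
    (hs : 0 ≤ s) (hadd : p + q ≤ r + s) (hmul : p * q ≤ r * s) :
    Real.sqrt p + Real.sqrt q ≤ Real.sqrt r + Real.sqrt s := by
  refine (sq_le_sq₀ (by positivity) (by positivity)).1 ?_
  have h := Real.sqrt_le_sqrt hmul
  rw [Real.sqrt_mul hp, Real.sqrt_mul hr] at h
  nlinarith [Real.sq_sqrt hp, Real.sq_sqrt hq, Real.sq_sqrt hr, Real.sq_sqrt hs]

theorem sqrt_four_mul (x : ℝ) : Real.sqrt (4 * x) = 2 * Real.sqrt x := by
  rw [Real.sqrt_mul (by norm_num), show (4 : ℝ) = 2 ^ 2 by norm_num, Real.sqrt_sq (by norm_num)]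

/-- The gap at an inner vertex with one inner neighbor is largest when it has few leaves. -/
theorem neg_auxf_one_le {a b : ℝ} (ha : 0 ≤ a) (hab : a ≤ b) :
    -auxf b 1 ≤ 2 * (Real.sqrt (a + 1 / 4) - Real.sqrt a) := by
  have h := sqrt_add_sqrt_le_sqrt_add_sqrt (p := b + 1 / 4) (q := a) (r := a + 1 / 4) (s := b)
    (by linarith) ha (by linarith) (by linarith) (by linarith) (by linarith)
  rw [auxf, show 4 * b + 4 * ((1 : ℝ) - 1) = 4 * b by ring,
    show 4 * b + 1 = 4 * (b + 1 / 4) by ring, sqrt_four_mul, sqrt_four_mul]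
  linarith

/-- `auxf` is decreasing in its first argument and increasing in its second one. -/
theorem le_auxf_of_two_le {a b y : ℝ} (ha : 0 ≤ a) (hab : a ≤ b) (hy : 2 ≤ y) :
    2 * (Real.sqrt (b + 1) - Real.sqrt (b + 1 / 2)) ≤ auxf a y := by
  have h₁ := sqrt_add_sqrt_le_sqrt_add_sqrt (p := b + 1) (q := a + 1 / 2) (r := a + 1)
    (s := b + 1 / 2) (by linarith) (by linarith) (by linarith) (by linarith) (by linarith)
    (by nlinarith)
  have h₂ := sqrt_add_sqrt_le_sqrt_add_sqrt (p := a + 1) (q := a + y / 4) (r := a + (y - 1))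
    (s := a + 1 / 2) (by linarith) (by linarith) (by linarith) (by linarith) (by linarith)
    (by nlinarith [mul_nonneg ha (sub_nonneg.2 hy)])
  rw [auxf, show 4 * a + 4 * (y - 1) = 4 * (a + (y - 1)) by ring,
    show 4 * a + y = 4 * (a + y / 4) by ring, sqrt_four_mul, sqrt_four_mul]
  linarith

theorem leafCount_add_innerCount (G : SimpleGraph V) [DecidableRel G.Adj] (v : V) :
    leafCount G v + innerCount G v = G.degree v := by
  rw [leafCount, innerCount, ← G.card_neighborFinset_eq_degree v,
    ← card_filter_add_card_filter_not (s := G.neighborFinset v) (fun w => G.degree w = 1)]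
  congr 2
  refine filter_congr fun w hw => ?_
  have : 0 < G.degree w :=
    (G.degree_pos_iff_exists_adj w).2 ⟨v, ((G.mem_neighborFinset v w).1 hw).symm⟩
  omega

/-- In a connected graph, a vertex all of whose neighbors are leaves is the center of a star. -/
theorem innerCount_pos_of_ne {G : SimpleGraph V} [DecidableRel G.Adj] (hG : G.Connected)
    {u v : V} (hu : u ∈ innerVerts G) (huv : u ≠ v) : 0 < innerCount G v := by
  by_contra h0
  have hleaf : ∀ w, G.Adj v w → G.degree w ≤ 1 := by
    intro w hw
    by_contra hlt
    exact h0 (card_pos.2 ⟨w, by simpa [hw] using hlt⟩)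
  have hclosed : ∀ w, w = v ∨ G.Adj v w := by
    intro w
    have hreach := (SimpleGraph.reachable_iff_reflTransGen v w).1 (hG.preconnected v w)
    induction hreach with
    | refl => exact Or.inl rfl
    | @tail b c _ hbc ih =>
      rcases ih with rfl | hvb
      · exact Or.inr hbc
      · left
        have hcard := hleaf b hvb
        rw [← G.card_neighborFinset_eq_degree] at hcard
        exact card_le_one.1 hcard c (by simpa using hbc) v (by simpa using hvb.symm)
  have hdeg : 2 ≤ G.degree u := by simpa [innerVerts] using hu
  rcases hclosed u with h | h
  · exact huv h
  · have := hleaf u h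
    omega

theorem sqrt_sub_two_mul_sqrt_eq_neg_auxf (G : SimpleGraph V) [DecidableRel G.Adj] (v : V) :
    Real.sqrt (3 * (leafCount G v : ℝ) + (G.degree v : ℝ)) -
      2 * Real.sqrt ((G.degree v : ℝ) - 1) = -auxf (leafCount G v) (innerCount G v) := by
  rw [← leafCount_add_innerCount G v, ← sqrt_four_mul, auxf]
  push_cast
  ring_nf

/-- Criterion iii): with `l₁ = min_{v ∈ V₁} l(v)` and `l₂ = max_{v ∈ V₂} l(v)`, if
`(√(l₂+1) - √(l₂+1/2))|V₂| ≥ (√(l₁+1/4) - √l₁)|V₁|`, then the new bound improves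
the Arizmendi–Dominguez bound. -/
theorem tree_criterion_iii (G : SimpleGraph V) [DecidableRel G.Adj]
    (hT : G.IsTree) (hn : 3 ≤ Fintype.card V)
    (V₁ V₂ : Finset V)
    (hV₁ : V₁ = (innerVerts G).filter (fun v => innerCount G v = 1))
    (hV₂ : V₂ = (innerVerts G).filter (fun v => 2 ≤ innerCount G v))
    (hne₁ : (V₁.image (leafCount G)).Nonempty)
    (hne₂ : (V₂.image (leafCount G)).Nonempty)
    (l₁ l₂ : ℕ)
    (hl₁ : l₁ = (V₁.image (leafCount G)).min' hne₁)
    (hl₂ : l₂ = (V₂.image (leafCount G)).max' hne₂)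
    (hcond : (Real.sqrt ((l₁ : ℝ) + 1 / 4) - Real.sqrt (l₁ : ℝ)) * (V₁.card : ℝ) ≤
      (Real.sqrt ((l₂ : ℝ) + 1) - Real.sqrt ((l₂ : ℝ) + 1 / 2)) * (V₂.card : ℝ)) :
    ∑ v ∈ innerVerts G, Real.sqrt (3 * (leafCount G v : ℝ) + (G.degree v : ℝ)) ≤
      (∑ v : V, 2 * Real.sqrt ((G.degree v : ℝ) - 1)) +
        2 * (Real.sqrt (G.maxDegree : ℝ) - Real.sqrt ((G.maxDegree : ℝ) - 1)) := by
  have hmem₁ : ∀ v ∈ V₁, v ∈ innerVerts G ∧ innerCount G v = 1 := by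
    intro v hv
    rw [hV₁] at hv
    simpa using hv
  have hmem₂ : ∀ v ∈ V₂, 2 ≤ innerCount G v := by
    intro v hv
    rw [hV₂] at hv
    exact (mem_filter.1 hv).2
  have hpos : ∀ v, 0 < innerCount G v := by
    obtain ⟨u, hu⟩ := image_nonempty.1 hne₁
    intro v
    rcases eq_or_ne u v with rfl | huv
    · rw [(hmem₁ u hu).2]
      exact one_pos
    · exact innerCount_pos_of_ne hT.connected (hmem₁ u hu).1 huv
  have hcompl : V₂ = (innerVerts G).filter (fun v => ¬ innerCount G v = 1) := by
    rw [hV₂]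
    refine filter_congr fun v _ => ?_
    have := hpos v
    omega
  have hsum₁ : ∑ v ∈ V₁, -auxf (leafCount G v) (innerCount G v) ≤
      V₁.card • (2 * (Real.sqrt ((l₁ : ℝ) + 1 / 4) - Real.sqrt (l₁ : ℝ))) := by
    refine sum_le_card_nsmul _ _ _ fun v hv => ?_
    have hle : l₁ ≤ leafCount G v := hl₁ ▸ min'_le _ _ (mem_image_of_mem _ hv)
    rw [(hmem₁ v hv).2, Nat.cast_one]
    exact neg_auxf_one_le (Nat.cast_nonneg _) (Nat.cast_le.2 hle)
  have hsum₂ : ∑ v ∈ V₂, -auxf (leafCount G v) (innerCount G v) ≤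
      V₂.card • -(2 * (Real.sqrt ((l₂ : ℝ) + 1) - Real.sqrt ((l₂ : ℝ) + 1 / 2))) := by
    refine sum_le_card_nsmul _ _ _ fun v hv => neg_le_neg ?_
    have hle : leafCount G v ≤ l₂ := hl₂ ▸ le_max' _ _ (mem_image_of_mem _ hv)
    exact le_auxf_of_two_le (Nat.cast_nonneg _) (Nat.cast_le.2 hle)
      (by exact_mod_cast hmem₂ v hv)
  have hinner : ∑ v ∈ innerVerts G, (Real.sqrt (3 * (leafCount G v : ℝ) + (G.degree v : ℝ)) -
      2 * Real.sqrt ((G.degree v : ℝ) - 1)) ≤ 0 := by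
    simp only [sqrt_sub_two_mul_sqrt_eq_neg_auxf]
    rw [← sum_filter_add_sum_filter_not (innerVerts G) (fun v => innerCount G v = 1),
      ← hV₁, ← hcompl]
    rw [nsmul_eq_mul] at hsum₁ hsum₂
    linarith
  rw [sum_sub_distrib] at hinner
  have hall : ∑ v ∈ innerVerts G, 2 * Real.sqrt ((G.degree v : ℝ) - 1) ≤
      ∑ v : V, 2 * Real.sqrt ((G.degree v : ℝ) - 1) :=
    sum_le_sum_of_subset_of_nonneg (subset_univ _) fun _ _ _ => by positivity
  have hmax : Real.sqrt ((G.maxDegree : ℝ) - 1) ≤ Real.sqrt (G.maxDegree : ℝ) :=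
    Real.sqrt_le_sqrt (by linarith)
  linarith

end GraphEnergy
end

section
/- For every real λ > 0, the series Σ_{k=2}^{∞} λᵏ√k / k! converges and Σ_{k=2}^{∞} λᵏ√k / k! ≤ ((λ + 2)·e^{λ} − (3λ + 2)) / √8. -/
theorem Real.sqrt_le_add_two_div_sqrt_eight {x : ℝ} (hx : 0 ≤ x) :
    √x ≤ (x + 2) / √8 := by
  rw [le_div_iff₀ (by positivity), ← Real.sqrt_mul hx]
  exact Real.sqrt_le_iff.2 ⟨by positivity, by nlinarith [sq_nonneg (x - 2)]⟩

theorem hasSum_pow_mul_add_two_div_factorial (l : ℝ) :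
    HasSum (fun k : ℕ => l ^ (k + 2) * ((k : ℝ) + 2 + 2) / (Nat.factorial (k + 2) : ℝ))
      ((l + 2) * Real.exp l - (3 * l + 2)) := by
  have h : HasSum (fun n : ℕ => l ^ n / (Nat.factorial n : ℝ)) (Real.exp l) := by
    rw [Real.exp_eq_exp_ℝ]
    exact NormedSpace.expSeries_div_hasSum_exp l
  have h₁ := ((hasSum_nat_add_iff' 1).2 h).mul_left l
  have h₂ := ((hasSum_nat_add_iff' 2).2 h).mul_left 2
  convert! h₁.add h₂ using 1
  · ext k
    have hk : (Nat.factorial (k + 1) : ℝ) ≠ 0 := by positivity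
    rw [Nat.factorial_succ (k + 1)]
    push_cast
    field_simp
    ring
  · simp [Finset.sum_range_succ]
    ring

/-- For every `λ > 0`, the series `∑_{k=2}^∞ λᵏ √k / k!` converges and its sum is at
most `((λ+2)e^λ - (3λ+2))/√8`. -/
theorem erSeries_le (l : ℝ) (hl : 0 < l) :
    Summable (fun k : ℕ => l ^ (k + 2) * Real.sqrt ((k : ℝ) + 2) / (Nat.factorial (k + 2) : ℝ)) ∧
    ∑' k : ℕ, l ^ (k + 2) * Real.sqrt ((k : ℝ) + 2) / (Nat.factorial (k + 2) : ℝ) ≤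
      ((l + 2) * Real.exp l - (3 * l + 2)) / Real.sqrt 8 := by
  have hsum := (hasSum_pow_mul_add_two_div_factorial l).div_const √8
  have hle (k : ℕ) : l ^ (k + 2) * √((k : ℝ) + 2) / (Nat.factorial (k + 2) : ℝ) ≤
      l ^ (k + 2) * ((k : ℝ) + 2 + 2) / (Nat.factorial (k + 2) : ℝ) / √8 := by
    rw [div_right_comm, mul_div_assoc _ _ √8]
    gcongr
    exact Real.sqrt_le_add_two_div_sqrt_eight (by positivity)
  have hs := Summable.of_nonneg_of_le (fun k => by positivity) hle hsum.summable
  exact ⟨hs, hasSum_le hle hs.hasSum hsum⟩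
end
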